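/- arXiv:math/9907027 — 3 statements merged into one kernel-verified Lean document; each statement's English description precedes it below -/
import Mathlib

section
/- Let m ≥ 1 and N ≥ 1, let A_0, …, A_m be N×N complex matrices with A_m invertible, and suppose that det(Σ_{k=0}^m ζ^k A_k) ≠ 0 for every real number ζ. Then for every tuple (w_0, …, w_{m−1}) of vectors in ℂᴺ there exists a unique pair of smooth functions u⁻, u⁺ : ℝ → ℂᴺ such that: both u⁻ and u⁺ satisfy Σ_{k=0}^m (−i)^k A_k (d^k u/dt^k)(t) = 0 for all t ∈ ℝ; u⁻ is bounded on [0,∞); u⁺ is bounded on (−∞,0]; and the j-th derivative of u⁻ + u⁺ at t = 0 equals w_j for every j = 0, …, m−1. -/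
/-- `U` is a solution of the linear system `U' = T U`. -/
def IsSolAux {V : Type*} [NormedAddCommGroup V] [NormedSpace ℂ V] (T : V →L[ℂ] V)
    (U : ℝ → V) : Prop := ∀ t : ℝ, HasDerivAt U (T (U t)) t

section AuxLinear

variable {V X : Type*} [NormedAddCommGroup V] [NormedSpace ℂ V] [NormedAddCommGroup X]
  [NormedSpace ℂ X]

theorem IsSolAux.add {T : V →L[ℂ] V} {U W : ℝ → V} (hU : IsSolAux T U) (hW : IsSolAux T W) :
    IsSolAux T (fun t => U t + W t) := fun t => by
  rw [map_add]; exact (hU t).add (hW t)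

theorem IsSolAux.sub {T : V →L[ℂ] V} {U W : ℝ → V} (hU : IsSolAux T U) (hW : IsSolAux T W) :
    IsSolAux T (fun t => U t - W t) := fun t => by
  rw [map_sub]; exact (hU t).sub (hW t)

theorem IsSolAux.smul {T : V →L[ℂ] V} {U : ℝ → V} (hU : IsSolAux T U) (c : ℂ) :
    IsSolAux T (fun t => c • U t) := fun t => by
  rw [map_smul]; exact (hU t).const_smul c

theorem IsSolAux.zero (T : V →L[ℂ] V) : IsSolAux T (fun _ => 0) := fun t => by
  simpa using hasDerivAt_const t (0 : V)

theorem IsSolAux.shift {T : V →L[ℂ] V} {U : ℝ → V} (hU : IsSolAux T U) (s : ℝ) :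
    IsSolAux T (fun t => U (t + s)) := fun t => (hU (t + s)).comp_add_const t s

theorem IsSolAux.unique {T : V →L[ℂ] V} {U W : ℝ → V} (hU : IsSolAux T U) (hW : IsSolAux T W)
    (h : U 0 = W 0) : U = W :=
  ODE_solution_unique_univ (v := fun _ => T) (s := fun _ => Set.univ) (K := ‖T‖₊) (t₀ := 0)
    (fun _ => T.lipschitz.lipschitzOnWith) (fun t => ⟨hU t, trivial⟩)
    (fun t => ⟨hW t, trivial⟩) h

theorem hasDerivAt_cexp_real (μ : ℂ) (t : ℝ) :
    HasDerivAt (fun t : ℝ => Complex.exp (t * μ)) (μ * Complex.exp (t * μ)) t := by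
  have h1 : HasDerivAt (fun t : ℝ => (t : ℂ) * μ) (1 * μ) t :=
    (Complex.ofRealCLM.hasDerivAt (x := t)).mul_const μ
  have := h1.cexp
  convert this using 1
  ring

/-- Truncated exponential. -/
noncomputable def truncExp (S : V →L[ℂ] V) (v : V) (k : ℕ) (t : ℝ) : V :=
  ∑ j ∈ Finset.range k, ((t ^ j / j.factorial : ℝ) : ℂ) • (S ^ j) v

theorem truncExp_succ (S : V →L[ℂ] V) (v : V) (k : ℕ) (t : ℝ) :
    truncExp S v (k + 1) t = truncExp S v k t + ((t ^ k / k.factorial : ℝ) : ℂ) • (S ^ k) v := by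
  simp [truncExp, Finset.sum_range_succ]

theorem truncExp_zero (S : V →L[ℂ] V) (v : V) (k : ℕ) : truncExp S v (k + 1) 0 = v := by
  simp [truncExp, Finset.sum_range_succ']

theorem hasDerivAt_truncExp (S : V →L[ℂ] V) (v : V) (k : ℕ) (t : ℝ) :
    HasDerivAt (truncExp S v (k + 1)) (S (truncExp S v k t)) t := by
  induction k with
  | zero =>
    have : truncExp S v (0 + 1) = fun _ => v := by ext t; simp [truncExp]
    rw [this]
    simpa [truncExp] using hasDerivAt_const t v
  | succ k ih =>
    have e : truncExp S v (k + 1 + 1) = fun t => truncExp S v (k + 1) t +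
      ((t ^ (k + 1) / (k + 1).factorial : ℝ) : ℂ) • (S ^ (k + 1)) v := by
      ext t; exact truncExp_succ _ _ _ _
    rw [e, truncExp_succ, map_add]
    refine ih.add ?_
    have h1 : HasDerivAt (fun t : ℝ => t ^ (k + 1) / ((k + 1).factorial : ℝ))
        (t ^ k / k.factorial) t := by
      have := (hasDerivAt_pow (k + 1) t).div_const ((k + 1).factorial : ℝ)
      have hk : (k.factorial : ℝ) ≠ 0 := by positivity
      have e2 : t ^ k / (k.factorial : ℝ) =
          ((k + 1 : ℕ) : ℝ) * t ^ (k + 1 - 1) / ((k + 1).factorial : ℝ) := by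
        rw [Nat.factorial_succ]
        push_cast
        field_simp
      rw [e2]
      exact this
    have h2 := (h1.ofReal_comp).smul_const ((S ^ (k + 1)) v)
    convert h2 using 1
    rw [map_smul, pow_succ' S k]
    rfl

theorem isSol_gen (T : V →L[ℂ] V) (μ : ℂ) (v : V) (k : ℕ)
    (hv : ((T - μ • (1 : V →L[ℂ] V)) ^ (k + 1)) v = 0) :
    IsSolAux T (fun t => Complex.exp (t * μ) • truncExp (T - μ • (1 : V →L[ℂ] V)) v (k + 1) t) := by
  intro t
  have h := (hasDerivAt_cexp_real μ t).smul (hasDerivAt_truncExp (T - μ • (1 : V →L[ℂ] V)) v k t)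
  refine HasDerivAt.congr_deriv h ?_
  symm
  set S := T - μ • (1 : V →L[ℂ] V) with hS
  have hST : S (truncExp S v k t) = S (truncExp S v (k + 1) t) := by
    rw [truncExp_succ, map_add, map_smul]
    have : S ((S ^ k) v) = 0 := by rw [← hv, pow_succ' S k]; rfl
    rw [this]; simp
  rw [hST]
  have : S (truncExp S v (k + 1) t) = T (truncExp S v (k + 1) t) - μ • truncExp S v (k + 1) t := by
    rw [hS]; simp
  rw [this, map_smul, smul_sub, smul_smul, mul_comm μ]
  abel

theorem bdd_gen (S : V →L[ℂ] V) (v : V) (μ : ℂ) (k : ℕ) :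
    ∃ C : ℝ, ∀ t : ℝ, t * μ.re ≤ 0 → μ.re ≠ 0 → ‖Complex.exp (t * μ) • truncExp S v k t‖ ≤ C := by
  refine ⟨∑ j ∈ Finset.range k, (|μ.re| ^ j)⁻¹ * ‖(S ^ j) v‖, fun t ht hμ => ?_⟩
  rw [truncExp, Finset.smul_sum]
  refine norm_sum_le_of_le _ fun j _ => ?_
  rw [smul_smul, norm_smul]
  gcongr
  rw [norm_mul, Complex.norm_exp, Complex.norm_real]
  have hre : ((t : ℂ) * μ).re = -(|t| * |μ.re|) := by
    rw [← abs_mul, abs_of_nonpos ht]; simp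
  rw [hre, Real.exp_neg]
  have h1 := Real.pow_div_factorial_le_exp (|t| * |μ.re|) (by positivity) j
  have hp : 0 < |μ.re| ^ j := by positivity
  rw [norm_div, norm_pow, Real.norm_eq_abs, Real.norm_natCast, inv_mul_le_iff₀ (Real.exp_pos _),
    ← div_eq_mul_inv, le_div_iff₀ hp]
  rw [mul_pow] at h1
  linarith [h1, (by ring : |t| ^ j / (j.factorial : ℝ) * |μ.re| ^ j =
    |t| ^ j * |μ.re| ^ j / (j.factorial : ℝ))]

theorem exists_decomp [FiniteDimensional ℂ V] (T : V →L[ℂ] V)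
    (hT : ∀ (μ : ℂ) (w : V), T w = μ • w → w ≠ 0 → μ.re ≠ 0) (v : V) :
    ∃ U W : ℝ → V, IsSolAux T U ∧ IsSolAux T W ∧ U 0 + W 0 = v ∧
      (∃ C : ℝ, ∀ t : ℝ, 0 ≤ t → ‖U t‖ ≤ C) ∧ (∃ C : ℝ, ∀ t : ℝ, t ≤ 0 → ‖W t‖ ≤ C) := by
  let G : Submodule ℂ V :=
    { carrier := {v | ∃ U W : ℝ → V, IsSolAux T U ∧ IsSolAux T W ∧ U 0 + W 0 = v ∧
        (∃ C : ℝ, ∀ t : ℝ, 0 ≤ t → ‖U t‖ ≤ C) ∧ (∃ C : ℝ, ∀ t : ℝ, t ≤ 0 → ‖W t‖ ≤ C)}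
      add_mem' := by
        rintro a b ⟨U, W, hU, hW, rfl, ⟨C, hC⟩, ⟨D, hD⟩⟩ ⟨U', W', hU', hW', rfl, ⟨C', hC'⟩, ⟨D', hD'⟩⟩
        refine ⟨_, _, hU.add hU', hW.add hW', by abel, ⟨C + C', fun t ht => ?_⟩,
          ⟨D + D', fun t ht => ?_⟩⟩
        · exact norm_add_le_of_le (hC t ht) (hC' t ht)
        · exact norm_add_le_of_le (hD t ht) (hD' t ht)
      zero_mem' := ⟨_, _, IsSolAux.zero T, IsSolAux.zero T, by simp, ⟨0, by simp⟩, ⟨0, by simp⟩⟩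
      smul_mem' := by
        rintro c a ⟨U, W, hU, hW, rfl, ⟨C, hC⟩, ⟨D, hD⟩⟩
        refine ⟨_, _, hU.smul c, hW.smul c, by simp, ⟨‖c‖ * C, fun t ht => ?_⟩,
          ⟨‖c‖ * D, fun t ht => ?_⟩⟩
        · rw [norm_smul]; gcongr; exact hC t ht
        · rw [norm_smul]; gcongr; exact hD t ht }
  suffices h : (⊤ : Submodule ℂ V) ≤ G from h (Submodule.mem_top (x := v))
  rw [← Module.End.iSup_maxGenEigenspace_eq_top (T : Module.End ℂ V)]
  refine iSup_le fun μ => ?_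
  intro x hx
  by_cases hx0 : x = 0
  · rw [hx0]; exact G.zero_mem
  have hμ : μ.re ≠ 0 := by
    have hne : Module.End.maxGenEigenspace (T : Module.End ℂ V) μ ≠ ⊥ := by
      intro h; rw [h] at hx; exact hx0 (by simpa using hx)
    have hev : Module.End.HasEigenvalue (T : Module.End ℂ V) μ := by
      obtain ⟨k, hk⟩ := (Module.End.mem_maxGenEigenspace _ _ _).1 hx
      refine Module.End.hasEigenvalue_of_hasGenEigenvalue (k := k) ?_
      intro h
      have : x ∈ Module.End.genEigenspace (T : Module.End ℂ V) μ k := by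
        rw [Module.End.mem_genEigenspace_nat]; exact hk
      rw [h] at this
      exact hx0 (by simpa using this)
    obtain ⟨w, hw⟩ := hev.exists_hasEigenvector
    exact hT μ w hw.apply_eq_smul hw.2
  obtain ⟨k, hk⟩ := (Module.End.mem_maxGenEigenspace _ _ _).1 hx
  have hk' : ((T - μ • (1 : V →L[ℂ] V)) ^ (k + 1)) x = 0 := by
    have e : ∀ j : ℕ, ∀ y : V, ((T - μ • (1 : V →L[ℂ] V)) ^ j) y =
        (((T : Module.End ℂ V) - μ • (1 : Module.End ℂ V)) ^ j) y := by
      intro j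
      induction j with
      | zero => intro y; simp
      | succ j ih =>
        intro y
        rw [pow_succ, pow_succ]
        exact ih _
    have h3 : ((T - μ • (1 : V →L[ℂ] V)) ^ k) x = 0 := (e k x).trans hk
    rw [pow_succ']
    change (T - μ • (1 : V →L[ℂ] V)) (((T - μ • (1 : V →L[ℂ] V)) ^ k) x) = 0
    rw [h3, map_zero]
  have hs := isSol_gen T μ x k hk'
  obtain ⟨C, hC⟩ := bdd_gen (T - μ • (1 : V →L[ℂ] V)) x μ (k + 1)
  rcases lt_or_gt_of_ne hμ with h | h
  · refine ⟨_, _, hs, IsSolAux.zero T, by simp [truncExp_zero], ⟨C, fun t ht => ?_⟩, ⟨0, by simp⟩⟩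
    exact hC t (mul_nonpos_of_nonneg_of_nonpos ht h.le) hμ
  · refine ⟨_, _, IsSolAux.zero T, hs, by simp [truncExp_zero], ⟨0, by simp⟩, ⟨C, fun t ht => ?_⟩⟩
    exact hC t (mul_nonpos_of_nonpos_of_nonneg ht h.le) hμ

theorem bdd_eq_zero [FiniteDimensional ℂ V] (T : V →L[ℂ] V) (P : V →L[ℂ] X)
    (hT : ∀ (μ : ℂ) (w : V), T w = μ • w → w ≠ 0 → μ.re ≠ 0)
    (hP : ∀ (μ : ℂ) (w : V), T w = μ • w → w ≠ 0 → P w ≠ 0)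
    (U : ℝ → V) (hU : IsSolAux T U) (hb : ∃ C : ℝ, ∀ t, ‖P (U t)‖ ≤ C) (s : ℝ) : U s = 0 := by
  let E : Submodule ℂ V :=
    { carrier := {v | ∃ U : ℝ → V, IsSolAux T U ∧ U 0 = v ∧ ∃ C : ℝ, ∀ t, ‖P (U t)‖ ≤ C}
      add_mem' := by
        rintro a b ⟨U, hU, rfl, ⟨C, hC⟩⟩ ⟨U', hU', rfl, ⟨C', hC'⟩⟩
        refine ⟨_, hU.add hU', rfl, ⟨C + C', fun t => ?_⟩⟩
        rw [map_add]
        exact norm_add_le_of_le (hC t) (hC' t)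
      zero_mem' := ⟨_, IsSolAux.zero T, rfl, ⟨0, by simp⟩⟩
      smul_mem' := by
        rintro c a ⟨U, hU, rfl, ⟨C, hC⟩⟩
        refine ⟨_, hU.smul c, rfl, ⟨‖c‖ * C, fun t => ?_⟩⟩
        rw [map_smul, norm_smul]; gcongr; exact hC t }
  have hmem : ∀ U : ℝ → V, IsSolAux T U → (∃ C : ℝ, ∀ t, ‖P (U t)‖ ≤ C) → ∀ s, U s ∈ E := by
    rintro U hU ⟨C, hC⟩ s
    exact ⟨_, hU.shift s, by simp, ⟨C, fun t => hC _⟩⟩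
  have hinv : ∀ v ∈ E, T v ∈ E := by
    rintro v ⟨U, hU, rfl, hC⟩
    have hcl : IsClosed (E : Set V) := E.closed_of_finiteDimensional
    have hd := (hU 0).tendsto_slope
    refine hcl.mem_of_tendsto hd (Filter.Eventually.of_forall fun t => ?_)
    rw [slope_def_module]
    have h1 := E.sub_mem (hmem U hU hC t) (hmem U hU hC 0)
    have h2 := E.smul_mem (((t - 0)⁻¹ : ℝ) : ℂ) h1
    rwa [Complex.coe_smul] at h2
  have hE : E = ⊥ := by
    by_contra hne
    have : Nontrivial E := Submodule.nontrivial_iff_ne_bot.2 hne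
    obtain ⟨μ, hμ⟩ := Module.End.exists_eigenvalue ((T : V →ₗ[ℂ] V).restrict hinv)
    obtain ⟨w, hw⟩ := hμ.exists_hasEigenvector
    have hw1 : T (w : V) = μ • (w : V) := congrArg Subtype.val hw.apply_eq_smul
    have hw0 : (w : V) ≠ 0 := fun h => hw.2 (Subtype.ext h)
    have hre := hT μ w hw1 hw0
    have hPw := hP μ w hw1 hw0
    obtain ⟨U, hU, hU0, C, hC⟩ := w.2
    have hsol : IsSolAux T (fun t => Complex.exp (t * μ) • (w : V)) := fun t => by
      have := (hasDerivAt_cexp_real μ t).smul_const (w : V)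
      convert this using 1
      rw [map_smul, hw1, smul_smul, mul_comm]
    have hUe := hU.unique hsol (by simp [hU0])
    have hpos : 0 < ‖P (w : V)‖ := norm_pos_iff.2 hPw
    have hb : ∀ x : ℝ, Real.exp x * ‖P (w : V)‖ ≤ C := by
      intro x
      have := hC (x / μ.re)
      rw [hUe] at this
      simp only [map_smul, norm_smul, Complex.norm_exp] at this
      have e : (((x / μ.re : ℝ) : ℂ) * μ).re = x := by
        rw [Complex.re_ofReal_mul]; field_simp
      rwa [e] at this
    have h1 := hb (C / ‖P (w : V)‖)
    have h2 := Real.add_one_le_exp (C / ‖P (w : V)‖)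
    have h3 : (C / ‖P (w : V)‖ + 1) * ‖P (w : V)‖ ≤ C := le_trans (by gcongr) h1
    rw [add_mul, div_mul_cancel₀ _ hpos.ne'] at h3
    linarith
  have := hmem U hU hb s
  rw [hE] at this
  simpa using this

end AuxLinear

section AuxCompanion

variable {n : ℕ} {X : Type*} [NormedAddCommGroup X] [NormedSpace ℂ X] [FiniteDimensional ℂ X]

/-- The companion operator. -/
noncomputable def compAux (B : (Fin (n + 1) → X) →ₗ[ℂ] X) :
    (Fin (n + 1) → X) →L[ℂ] (Fin (n + 1) → X) :=
  LinearMap.toContinuousLinearMap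
    (LinearMap.pi fun j => if h : j.val < n then LinearMap.proj ⟨j.val + 1, by omega⟩ else B)

theorem compAux_lt (B : (Fin (n + 1) → X) →ₗ[ℂ] X) (z : Fin (n + 1) → X) (j : ℕ) (h : j < n) :
    compAux B z ⟨j, by omega⟩ = z ⟨j + 1, by omega⟩ := by
  simp [compAux, h]

theorem compAux_last (B : (Fin (n + 1) → X) →ₗ[ℂ] X) (z : Fin (n + 1) → X) :
    compAux B z ⟨n, by omega⟩ = B z := by
  simp [compAux]

theorem compAux_pow (B : (Fin (n + 1) → X) →ₗ[ℂ] X) (j : ℕ) (h : j < n + 1)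
    (z : Fin (n + 1) → X) : ((compAux B) ^ j) z 0 = z ⟨j, h⟩ := by
  induction j generalizing z with
  | zero => rfl
  | succ j ih =>
    rw [pow_succ]
    exact (ih (by omega) (compAux B z)).trans (compAux_lt B z j (by omega))

theorem compAux_pow_last (B : (Fin (n + 1) → X) →ₗ[ℂ] X)
    (z : Fin (n + 1) → X) : ((compAux B) ^ (n + 1)) z 0 = B z := by
  rw [pow_succ]
  exact (compAux_pow B n (by omega) (compAux B z)).trans (compAux_last B z)

theorem iteratedDeriv_compAux (B : (Fin (n + 1) → X) →ₗ[ℂ] X) {U : ℝ → (Fin (n + 1) → X)}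
    (hU : IsSolAux (compAux B) U) (j : ℕ) :
    iteratedDeriv j (fun t => U t 0) = fun t => ((compAux B) ^ j) (U t) 0 := by
  induction j with
  | zero => simp
  | succ j ih =>
    rw [iteratedDeriv_succ, ih]
    ext1 t
    have h1 := (((compAux B) ^ j).restrictScalars ℝ).hasFDerivAt.comp_hasDerivAt t (hU t)
    have h2 := (hasDerivAt_pi.1 h1) 0
    rw [pow_succ]
    exact h2.deriv

theorem contDiff_compAux (B : (Fin (n + 1) → X) →ₗ[ℂ] X) {U : ℝ → (Fin (n + 1) → X)}
    (hU : IsSolAux (compAux B) U) : ContDiff ℝ (⊤ : ℕ∞) (fun t => U t 0) := by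
  refine contDiff_of_differentiable_iteratedDeriv fun j _ => ?_
  rw [iteratedDeriv_compAux B hU]
  intro t
  have h1 := (((compAux B) ^ j).restrictScalars ℝ).hasFDerivAt.comp_hasDerivAt t (hU t)
  exact ((hasDerivAt_pi.1 h1) 0).differentiableAt

theorem isSol_of_smooth (B : (Fin (n + 1) → X) →ₗ[ℂ] X) {u : ℝ → X}
    (hu : ContDiff ℝ (⊤ : ℕ∞) u)
    (h : ∀ t, iteratedDeriv (n + 1) u t = B (fun j : Fin (n + 1) => iteratedDeriv j u t)) :
    IsSolAux (compAux B) (fun t => fun j : Fin (n + 1) => iteratedDeriv j u t) := by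
  intro t
  rw [hasDerivAt_pi]
  rintro ⟨j, hj⟩
  have hd : HasDerivAt (iteratedDeriv j u) (iteratedDeriv (j + 1) u t) t := by
    rw [iteratedDeriv_succ]
    exact ((hu.differentiable_iteratedDeriv j (by exact_mod_cast ENat.natCast_lt_top j)) t).hasDerivAt
  convert hd using 1
  by_cases hjn : j < n
  · exact compAux_lt B _ j hjn
  · obtain rfl : j = n := by omega
    rw [h t]
    exact compAux_last B _

theorem compAux_eig (B : (Fin (n + 1) → X) →ₗ[ℂ] X) (μ : ℂ) (w : Fin (n + 1) → X)
    (hw : compAux B w = μ • w) (j : Fin (n + 1)) : w j = μ ^ (j : ℕ) • w 0 := by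
  obtain ⟨j, hj⟩ := j
  induction j with
  | zero => simp
  | succ j ih =>
    have := compAux_lt B w j (by omega)
    rw [hw] at this
    rw [← this, Pi.smul_apply, ih (by omega), smul_smul, pow_succ']

end AuxCompanion

theorem stmt4 (m N : ℕ) (hm : 1 ≤ m) (hN : 1 ≤ N)
    (A : Fin (m + 1) → Matrix (Fin N) (Fin N) ℂ)
    (hAm : IsUnit (A (Fin.last m)))
    (hell : ∀ ζ : ℝ, (∑ k : Fin (m + 1), ((ζ : ℂ) ^ (k : ℕ)) • A k).det ≠ 0)
    (w : Fin m → (Fin N → ℂ)) :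
    ∃! p : (ℝ → (Fin N → ℂ)) × (ℝ → (Fin N → ℂ)),
      ContDiff ℝ (⊤ : ℕ∞) p.1 ∧ ContDiff ℝ (⊤ : ℕ∞) p.2 ∧
      (∀ t : ℝ, ∑ k : Fin (m + 1),
        ((-Complex.I) ^ (k : ℕ)) • (A k).mulVec (iteratedDeriv (k : ℕ) p.1 t) = 0) ∧
      (∀ t : ℝ, ∑ k : Fin (m + 1),
        ((-Complex.I) ^ (k : ℕ)) • (A k).mulVec (iteratedDeriv (k : ℕ) p.2 t) = 0) ∧
      (∃ C : ℝ, ∀ t : ℝ, 0 ≤ t → ‖p.1 t‖ ≤ C) ∧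
      (∃ C : ℝ, ∀ t : ℝ, t ≤ 0 → ‖p.2 t‖ ≤ C) ∧
      (∀ j : Fin m, iteratedDeriv (j : ℕ) (fun t => p.1 t + p.2 t) 0 = w j) := by
  obtain ⟨n, rfl⟩ : ∃ n, m = n + 1 := ⟨m - 1, by omega⟩
  let Q : (Fin (n + 1) → (Fin N → ℂ)) →ₗ[ℂ] (Fin N → ℂ) :=
    ∑ k : Fin (n + 1), ((-Complex.I) ^ (k : ℕ)) •
      (Matrix.mulVecLin (A k.castSucc)).comp (LinearMap.proj k)
  let B : (Fin (n + 1) → (Fin N → ℂ)) →ₗ[ℂ] (Fin N → ℂ) :=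
    (-((-Complex.I) ^ (n + 1))⁻¹) • (Matrix.mulVecLin (A (Fin.last (n + 1)))⁻¹).comp Q
  have hdet : IsUnit (A (Fin.last (n + 1))).det := (Matrix.isUnit_iff_isUnit_det _).1 hAm
  have hI : (-Complex.I) ^ (n + 1) ≠ 0 := pow_ne_zero _ (neg_ne_zero.2 Complex.I_ne_zero)
  have hQ : ∀ z, Q z = ∑ k : Fin (n + 1), ((-Complex.I) ^ (k : ℕ)) •
      (A k.castSucc).mulVec (z k) := by
    intro z; simp [Q, LinearMap.sum_apply]
  have hB : ∀ z y, Q z + ((-Complex.I) ^ (n + 1)) • (A (Fin.last (n + 1))).mulVec y = 0 ↔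
      y = B z := by
    intro z y
    have hBz : B z = (-((-Complex.I) ^ (n + 1))⁻¹) • (A (Fin.last (n + 1)))⁻¹.mulVec (Q z) := rfl
    constructor
    · intro h
      rw [hBz, eq_neg_of_add_eq_zero_left h, Matrix.mulVec_neg, Matrix.mulVec_smul,
        Matrix.mulVec_mulVec, Matrix.nonsing_inv_mul _ hdet, Matrix.one_mulVec, neg_smul, smul_neg,
        neg_neg, smul_smul, inv_mul_cancel₀ hI, one_smul]
    · rintro rfl
      rw [hBz, Matrix.mulVec_smul, Matrix.mulVec_mulVec, Matrix.mul_nonsing_inv _ hdet,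
        Matrix.one_mulVec, smul_smul, mul_neg, mul_inv_cancel₀ hI, neg_one_smul, add_neg_cancel]
  let T := compAux B
  have heq : ∀ (u : ℝ → (Fin N → ℂ)) (t : ℝ),
      (∑ k : Fin (n + 1 + 1), ((-Complex.I) ^ (k : ℕ)) •
        (A k).mulVec (iteratedDeriv (k : ℕ) u t) = 0) ↔
      iteratedDeriv (n + 1) u t = B (fun j : Fin (n + 1) => iteratedDeriv j u t) := by
    intro u t
    rw [← hB, hQ, Fin.sum_univ_castSucc]
    rfl
  have hP : ∀ (μ : ℂ) (w : Fin (n + 1) → (Fin N → ℂ)), T w = μ • w → w ≠ 0 → w 0 ≠ 0 := by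
    intro μ w hw hw0 h
    apply hw0
    ext1 j
    rw [compAux_eig B μ w hw j, h]; simp
  have hT : ∀ (μ : ℂ) (w : Fin (n + 1) → (Fin N → ℂ)), T w = μ • w → w ≠ 0 → μ.re ≠ 0 := by
    intro μ w hw hw0 hre
    have h0 := hP μ w hw hw0
    have hlast : B w = μ ^ (n + 1) • w 0 := by
      have h1 := compAux_last B w
      have h2 := compAux_eig B μ w hw ⟨n, by omega⟩
      change T w _ = _ at h1
      rw [hw, Pi.smul_apply, h2, smul_smul] at h1
      rw [← h1, pow_succ']
    have hz := (hB w (μ ^ (n + 1) • w 0)).2 hlast.symm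
    have hζ : -Complex.I * μ = (μ.im : ℂ) := by
      apply Complex.ext <;> simp [hre]
    have hzero : (∑ k : Fin (n + 1 + 1), ((μ.im : ℂ) ^ (k : ℕ)) • A k).mulVec (w 0) = 0 := by
      rw [← hz, hQ, Matrix.sum_mulVec, Fin.sum_univ_castSucc]
      congr 1
      · refine Finset.sum_congr rfl fun k _ => ?_
        rw [compAux_eig B μ w hw k, Matrix.mulVec_smul, smul_smul, ← mul_pow, hζ,
          Matrix.smul_mulVec]
        rfl
      · rw [Matrix.mulVec_smul, smul_smul, ← mul_pow, hζ, Matrix.smul_mulVec]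
        rfl
    exact hell μ.im (Matrix.exists_mulVec_eq_zero_iff.1 ⟨w 0, h0, hzero⟩)
  have hode : ∀ U : ℝ → (Fin (n + 1) → (Fin N → ℂ)), IsSolAux T U → ∀ t : ℝ,
      ∑ k : Fin (n + 1 + 1), ((-Complex.I) ^ (k : ℕ)) •
        (A k).mulVec (iteratedDeriv (k : ℕ) (fun t => U t 0) t) = 0 := by
    intro U hU t
    rw [heq]
    rw [iteratedDeriv_compAux B hU]
    simp only [compAux_pow_last]
    congr 1
    ext1 j
    rw [iteratedDeriv_compAux B hU]
    exact (compAux_pow B j j.2 (U t)).symm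
  have hadd : ∀ u v : ℝ → (Fin N → ℂ), ContDiff ℝ (⊤ : ℕ∞) u → ContDiff ℝ (⊤ : ℕ∞) v → ∀ j : ℕ,
      iteratedDeriv j (fun t => u t + v t) 0 = iteratedDeriv j u 0 + iteratedDeriv j v 0 := by
    intro u v hu hv j
    have hj : ((j : ℕ∞) : WithTop ℕ∞) ≤ ((⊤ : ℕ∞) : WithTop ℕ∞) := by exact_mod_cast le_top
    exact iteratedDeriv_fun_add (hu.of_le hj).contDiffAt (hv.of_le hj).contDiffAt
  obtain ⟨U, W, hU, hW, h0, ⟨C, hC⟩, ⟨D, hD⟩⟩ := exists_decomp T hT w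
  refine existsUnique_of_exists_of_unique ⟨(fun t => U t 0, fun t => W t 0), ?_⟩ ?_
  · refine ⟨contDiff_compAux B hU, contDiff_compAux B hW, hode U hU, hode W hW,
      ⟨C, fun t ht => (norm_le_pi_norm (U t) 0).trans (hC t ht)⟩,
      ⟨D, fun t ht => (norm_le_pi_norm (W t) 0).trans (hD t ht)⟩, fun j => ?_⟩
    rw [hadd _ _ (contDiff_compAux B hU) (contDiff_compAux B hW), iteratedDeriv_compAux B hU,
      iteratedDeriv_compAux B hW, ← h0]
    exact congrArg₂ (· + ·) (compAux_pow B j j.2 (U 0)) (compAux_pow B j j.2 (W 0))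
  · rintro ⟨a, b⟩ ⟨c, d⟩ ⟨ha, hb, hae, hbe, ⟨Ca, hCa⟩, ⟨Cb, hCb⟩, hab⟩
      ⟨hc, hd, hce, hde, ⟨Cc, hCc⟩, ⟨Cd, hCd⟩, hcd⟩
    dsimp only at *
    have sa := isSol_of_smooth B ha (fun t => (heq a t).1 (hae t))
    have sb := isSol_of_smooth B hb (fun t => (heq b t).1 (hbe t))
    have sc := isSol_of_smooth B hc (fun t => (heq c t).1 (hce t))
    have sd := isSol_of_smooth B hd (fun t => (heq d t).1 (hde t))
    have s1 := sa.sub sc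
    have s2 := sd.sub sb
    have e12 := s1.unique s2 (by
      ext1 j
      have h1 := hab j
      have h2 := hcd j
      rw [hadd _ _ ha hb] at h1
      rw [hadd _ _ hc hd, ← h1] at h2
      simp only [Pi.sub_apply]
      rw [sub_eq_sub_iff_add_eq_add, ← h2, add_comm])
    have e0 : ∀ t, a t - c t = d t - b t := fun t => by
      simpa using congrFun (congrFun e12 t) 0
    have hz := bdd_eq_zero T (ContinuousLinearMap.proj (R := ℂ) (0 : Fin (n + 1))) hT hP _ s1
      ⟨max (Ca + Cc) (Cd + Cb), fun t => by
        have e1 : (ContinuousLinearMap.proj (R := ℂ) (φ := fun _ : Fin (n + 1) => Fin N → ℂ)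
          (0 : Fin (n + 1))) ((fun j : Fin (n + 1) => iteratedDeriv j a t) -
            (fun j : Fin (n + 1) => iteratedDeriv j c t)) = a t - c t := by simp
        rw [e1]
        rcases le_total 0 t with ht | ht
        · exact (norm_sub_le_of_le (hCa t ht) (hCc t ht)).trans (le_max_left _ _)
        · rw [e0]
          exact (norm_sub_le_of_le (hCd t ht) (hCb t ht)).trans (le_max_right _ _)⟩
    have hac : ∀ t, a t - c t = 0 := fun t => by
      simpa using congrFun (hz t) 0
    refine Prod.ext (funext fun t => sub_eq_zero.1 (hac t)) (funext fun t => ?_)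
    exact (sub_eq_zero.1 ((e0 t).symm.trans (hac t))).symm
end

section
/- Let V be a finite-dimensional complex vector space and f an endomorphism of V all of whose eigenvalues have nonzero imaginary part. Let q be the linear projection (q ∘ q = q) whose range is N = Σ_{Im μ < 0} K_μ(f) and whose kernel is P = Σ_{Im μ > 0} K_μ(f). Then for every τ ∈ [0,1], the spectrum of the endomorphism g_τ = (1−τ)·f − iτ·(2q − id) equals { (1−τ)λ − iτ : λ an eigenvalue of f with Im λ < 0 } ∪ { (1−τ)λ + iτ : λ an eigenvalue of f with Im λ > 0 }; in particular, every eigenvalue of g_τ has nonzero imaginary part for every τ ∈ [0,1]. -/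
theorem aux_inv {V : Type*} [AddCommGroup V] [Module ℂ V] (f : Module.End ℂ V) (S : Set ℂ)
    (x : V) (hx : x ∈ ⨆ μ ∈ S, f.maxGenEigenspace μ) :
    f x ∈ ⨆ μ ∈ S, f.maxGenEigenspace μ := by
  have h : (⨆ μ ∈ S, f.maxGenEigenspace μ) ≤
      (⨆ μ ∈ S, f.maxGenEigenspace μ).comap f := by
    refine iSup₂_le fun μ hμ y hy => ?_
    exact (le_iSup₂_of_le (f := fun μ (_ : μ ∈ S) => f.maxGenEigenspace μ) μ hμ le_rfl)
      (Module.End.mapsTo_maxGenEigenspace_of_comm (Commute.refl f) μ hy)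
  exact h hx

theorem aux_mem {V : Type*} [AddCommGroup V] [Module ℂ V] (f : Module.End ℂ V) (S : Set ℂ)
    (μ : ℂ) (hμ : μ ∈ S) (x : V) (hx : f x = μ • x) :
    x ∈ ⨆ μ ∈ S, f.maxGenEigenspace μ :=
  (le_iSup₂_of_le (f := fun μ (_ : μ ∈ S) => f.maxGenEigenspace μ) μ hμ le_rfl)
    (Module.End.eigenspace_le_maxGenEigenspace (Module.End.mem_eigenspace_iff.2 hx))

theorem aux_ex {V : Type*} [AddCommGroup V] [Module ℂ V] (f : Module.End ℂ V) (S : Set ℂ)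
    (x : V) (hx : x ∈ ⨆ μ ∈ S, f.maxGenEigenspace μ) (h0 : x ≠ 0) :
    ∃ μ ∈ S, f.HasEigenvalue μ := by
  by_contra! h
  apply h0
  have : (⨆ μ ∈ S, f.maxGenEigenspace μ) ≤ ⊥ := by
    refine iSup₂_le fun μ hμ => ?_
    by_contra hne
    apply h μ hμ
    have h1 : f.HasUnifEigenvalue μ ⊤ := fun h2 => hne (le_of_eq h2)
    exact (Module.End.hasUnifEigenvalue_iff_hasUnifEigenvalue_one (by simp)).1 h1
  simpa using this hx

/-- The main step: an eigenvector `y` of `a f + b` lying in one of the two summands. -/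
theorem aux_main {V : Type*} [AddCommGroup V] [Module ℂ V] (f : Module.End ℂ V) (S T : Set ℂ)
    (hST : ∀ μ, f.HasEigenvalue μ → μ ∈ S ∨ μ ∈ T)
    (y : V) (hy0 : y ≠ 0) (hy : y ∈ ⨆ μ ∈ S, f.maxGenEigenspace μ)
    (hyT : y ∉ ⨆ μ ∈ T, f.maxGenEigenspace μ) (a c : ℂ) (h : a • f y = c • y) :
    ∃ μ ∈ S, f.HasEigenvalue μ ∧ a * μ = c := by
  by_cases ha : a = 0
  · obtain ⟨μ, hμ, he⟩ := aux_ex f S y hy hy0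
    refine ⟨μ, hμ, he, ?_⟩
    subst ha
    rw [zero_smul] at h
    rcases smul_eq_zero.1 h.symm with h | h
    · simp [h]
    · exact absurd h hy0
  · have hfy : f y = (a⁻¹ * c) • y := by
      rw [mul_smul, ← h, smul_smul, inv_mul_cancel₀ ha, one_smul]
    have he : f.HasEigenvalue (a⁻¹ * c) :=
      Module.End.hasEigenvalue_of_hasEigenvector
        (Module.End.hasEigenvector_iff.2 ⟨Module.End.mem_eigenspace_iff.2 hfy, hy0⟩)
    refine ⟨a⁻¹ * c, ?_, he, by field_simp⟩
    rcases hST _ he with h1 | h1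
    · exact h1
    · exact absurd (aux_mem f T _ h1 y hfy) hyT

/-- Let `f` be an endomorphism of a finite-dimensional complex vector space all of
whose eigenvalues have nonzero imaginary part, and let `q` be the projection with range
`N = Σ_{Im μ < 0} K_μ(f)` and kernel `P = Σ_{Im μ > 0} K_μ(f)`. Then for every `τ ∈ [0,1]` the
spectrum of `g_τ = (1-τ)•f - iτ•(2q - 1)` is
`{(1-τ)λ - iτ : λ eigenvalue of f, Im λ < 0} ∪ {(1-τ)λ + iτ : λ eigenvalue of f, Im λ > 0}`,
and in particular every element of the spectrum of `g_τ` has nonzero imaginary part. -/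
theorem stmt6 (V : Type*) [AddCommGroup V] [Module ℂ V] [FiniteDimensional ℂ V]
    (f : Module.End ℂ V)
    (hf : ∀ μ : ℂ, f.HasEigenvalue μ → μ.im ≠ 0)
    (q : Module.End ℂ V) (hq : q * q = q)
    (hqN : LinearMap.range q = ⨆ μ ∈ {μ : ℂ | μ.im < 0}, f.maxGenEigenspace μ)
    (hqP : LinearMap.ker q = ⨆ μ ∈ {μ : ℂ | 0 < μ.im}, f.maxGenEigenspace μ)
    (τ : ℝ) (hτ : τ ∈ Set.Icc (0 : ℝ) 1)
    (g : Module.End ℂ V)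
    (hg : g = ((1 - τ : ℝ) : ℂ) • f - (((τ : ℝ) : ℂ) * Complex.I) • ((2 : ℂ) • q - 1)) :
    spectrum ℂ g =
      ((fun lam : ℂ => ((1 - τ : ℝ) : ℂ) * lam - Complex.I * (τ : ℂ)) ''
          {lam : ℂ | f.HasEigenvalue lam ∧ lam.im < 0}) ∪
      ((fun lam : ℂ => ((1 - τ : ℝ) : ℂ) * lam + Complex.I * (τ : ℂ)) ''
          {lam : ℂ | f.HasEigenvalue lam ∧ 0 < lam.im}) ∧
    ∀ μ ∈ spectrum ℂ g, μ.im ≠ 0 := by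
  have hqq : ∀ x, q (q x) = q x := fun x => by
    rw [← Module.End.mul_apply, hq]
  have hgx : ∀ x, g x = ((1 - τ : ℝ) : ℂ) • f x - ((τ : ℂ) * Complex.I) • ((2 : ℂ) • q x - x) := by
    intro x; rw [hg]; simp
  have hrange : ∀ x, x ∈ LinearMap.range q ↔ q x = x := fun x =>
    ⟨by rintro ⟨z, rfl⟩; exact hqq z, fun h => ⟨x, h⟩⟩
  have hcomm : ∀ x, q (f x) = f (q x) := by
    intro x
    have h1 : q (f (q x)) = f (q x) := by
      rw [← hrange, hqN]
      apply aux_inv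
      rw [← hqN]
      exact ⟨x, rfl⟩
    have h2 : q (f (x - q x)) = 0 := by
      rw [← LinearMap.mem_ker, hqP]
      apply aux_inv
      rw [← hqP, LinearMap.mem_ker, map_sub, hqq, sub_self]
    rw [map_sub, map_sub, sub_eq_zero] at h2
    rw [h2, h1]
  have hgq : ∀ x, g (q x) = q (g x) := by
    intro x
    rw [hgx, hgx]
    simp only [map_sub, map_smul, hcomm, hqq]
  have key : spectrum ℂ g =
      ((fun lam : ℂ => ((1 - τ : ℝ) : ℂ) * lam - Complex.I * (τ : ℂ)) ''
          {lam : ℂ | f.HasEigenvalue lam ∧ lam.im < 0}) ∪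
      ((fun lam : ℂ => ((1 - τ : ℝ) : ℂ) * lam + Complex.I * (τ : ℂ)) ''
          {lam : ℂ | f.HasEigenvalue lam ∧ 0 < lam.im}) := by
    ext ν
    rw [← Module.End.hasEigenvalue_iff_mem_spectrum]
    constructor
    · intro hν
      obtain ⟨x, hx⟩ := hν.exists_hasEigenvector
      have hgν : g x = ν • x := hx.apply_eq_smul
      have hx0 : x ≠ 0 := hx.2
      by_cases hqx : q x = 0
      · right
        have hk : x ∈ LinearMap.ker q := hqx
        obtain ⟨μ, hμ, he, hc⟩ := aux_main f {μ : ℂ | 0 < μ.im} {μ : ℂ | μ.im < 0}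
          (fun μ h => (hf μ h).lt_or_gt.symm) x hx0 (hqP ▸ hk)
          (by
            rw [← hqN, hrange, hqx]
            exact fun h => hx0 h.symm)
          ((1 - τ : ℝ) : ℂ) (ν - Complex.I * τ) (by
            rw [sub_smul, ← hgν, hgx, hqx]
            module)
        exact ⟨μ, ⟨he, hμ⟩, by simp only [hc]; ring⟩
      · left
        have hgy : g (q x) = ν • q x := by rw [hgq, hgν, map_smul]
        obtain ⟨μ, hμ, he, hc⟩ := aux_main f {μ : ℂ | μ.im < 0} {μ : ℂ | 0 < μ.im}
          (fun μ h => (hf μ h).lt_or_gt) (q x) hqx (hqN ▸ ⟨x, rfl⟩)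
          (by
            rw [← hqP, LinearMap.mem_ker, hqq]
            exact hqx)
          ((1 - τ : ℝ) : ℂ) (ν + Complex.I * τ) (by
            rw [add_smul, ← hgy, hgx, hqq]
            module)
        exact ⟨μ, ⟨he, hμ⟩, by simp only [hc]; ring⟩
    · rintro (⟨μ, ⟨he, hμ⟩, rfl⟩ | ⟨μ, ⟨he, hμ⟩, rfl⟩)
      · obtain ⟨x, hx⟩ := he.exists_hasEigenvector
        have hfx : f x = μ • x := hx.apply_eq_smul
        have hqx : q x = x := by
          rw [← hrange, hqN]
          exact aux_mem f _ μ hμ x hfx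
        refine Module.End.hasEigenvalue_of_hasEigenvector
          (Module.End.hasEigenvector_iff.2 ⟨Module.End.mem_eigenspace_iff.2 ?_, hx.2⟩)
        rw [hgx, hqx, hfx]
        module
      · obtain ⟨x, hx⟩ := he.exists_hasEigenvector
        have hfx : f x = μ • x := hx.apply_eq_smul
        have hqx : q x = 0 := by
          rw [← LinearMap.mem_ker, hqP]
          exact aux_mem f _ μ hμ x hfx
        refine Module.End.hasEigenvalue_of_hasEigenvector
          (Module.End.hasEigenvector_iff.2 ⟨Module.End.mem_eigenspace_iff.2 ?_, hx.2⟩)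
        rw [hgx, hqx, hfx]
        module
  refine ⟨key, ?_⟩
  rw [key]
  obtain ⟨h0, h1⟩ := hτ
  rintro ν (⟨μ, ⟨he, hμ⟩, rfl⟩ | ⟨μ, ⟨he, hμ⟩, rfl⟩)
  · have hμ' : μ.im < 0 := hμ
    have him : (((1 - τ : ℝ) : ℂ) * μ - Complex.I * (τ : ℂ)).im = (1 - τ) * μ.im - τ := by
      rw [Complex.sub_im, Complex.im_ofReal_mul]
      simp
    simp only [him]
    apply ne_of_lt
    rcases h0.eq_or_lt with h | h
    · subst h; linarith
    · linarith [mul_nonneg (sub_nonneg.2 h1) (neg_nonneg.2 hμ'.le)]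
  · have hμ' : 0 < μ.im := hμ
    have him : (((1 - τ : ℝ) : ℂ) * μ + Complex.I * (τ : ℂ)).im = (1 - τ) * μ.im + τ := by
      rw [Complex.add_im, Complex.im_ofReal_mul]
      simp
    simp only [him]
    apply ne_of_gt
    rcases h0.eq_or_lt with h | h
    · subst h; linarith
    · linarith [mul_nonneg (sub_nonneg.2 h1) hμ'.le]
end

section
/- Let V be a finite-dimensional complex vector space and f an endomorphism of V all of whose eigenvalues have nonzero imaginary part. Let q be the linear projection (q ∘ q = q) whose range is N = Σ_{Im μ < 0} K_μ(f) and whose kernel is P = Σ_{Im μ > 0} K_μ(f). Then for every τ ∈ [0,1], the sum of the generalized eigenspaces of g_τ = (1−τ)·f − iτ·(2q − id) at eigenvalues with negative imaginary part is equal to N; in other words, the negative-imaginary spectral subspace is constant along the homotopy g_τ. -/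
theorem gen_aux {V : Type*} [AddCommGroup V] [Module ℂ V] (f g : Module.End ℂ V) (c d μ : ℂ)
    (h : ∀ x ∈ f.maxGenEigenspace μ, g x = c • f x + d • x) :
    f.maxGenEigenspace μ ≤ g.maxGenEigenspace (c * μ + d) := by
  have key : ∀ k : ℕ, ∀ x ∈ f.maxGenEigenspace μ,
      ((g - (c * μ + d) • (1 : Module.End ℂ V)) ^ k) x
        = c ^ k • ((f - μ • (1 : Module.End ℂ V)) ^ k) x := by
    intro k
    induction k with
    | zero => intro x _; simp
    | succ k ih =>
      intro x hx
      have h1 : (g - (c * μ + d) • (1 : Module.End ℂ V)) x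
          = c • (f - μ • (1 : Module.End ℂ V)) x := by
        simp only [LinearMap.sub_apply, LinearMap.smul_apply, Module.End.one_apply, h x hx]
        module
      have h2 : (f - μ • (1 : Module.End ℂ V)) x ∈ f.maxGenEigenspace μ := by
        have := Module.End.mapsTo_maxGenEigenspace_of_comm (Commute.refl f) μ hx
        simp only [LinearMap.sub_apply, LinearMap.smul_apply, Module.End.one_apply]
        exact Submodule.sub_mem _ this (Submodule.smul_mem _ _ hx)
      rw [pow_succ, Module.End.mul_apply, h1, map_smul, ih _ h2, pow_succ (f - _),
        Module.End.mul_apply, smul_smul, pow_succ' c]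
  intro x hx
  obtain ⟨k, hk⟩ := (Module.End.mem_maxGenEigenspace f μ x).1 hx
  exact (Module.End.mem_maxGenEigenspace g _ x).2 ⟨k, by rw [key k x hx, hk, smul_zero]⟩

/-- Let `f` be an endomorphism of a finite-dimensional complex vector space all of
whose eigenvalues have nonzero imaginary part, and let `q` be the projection with range
`N = Σ_{Im μ < 0} K_μ(f)` and kernel `P = Σ_{Im μ > 0} K_μ(f)`. Then for every `τ ∈ [0,1]`, the
sum of the generalized eigenspaces of `g_τ = (1-τ)•f - iτ•(2q - 1)` at eigenvalues with negative
imaginary part equals `N`: the negative-imaginary spectral subspace is constant along the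
homotopy. -/
theorem stmt7 (V : Type*) [AddCommGroup V] [Module ℂ V] [FiniteDimensional ℂ V]
    (f : Module.End ℂ V)
    (hf : ∀ μ : ℂ, f.HasEigenvalue μ → μ.im ≠ 0)
    (N : Submodule ℂ V)
    (hN : N = ⨆ μ ∈ {μ : ℂ | μ.im < 0}, f.maxGenEigenspace μ)
    (q : Module.End ℂ V) (hq : q * q = q)
    (hqN : LinearMap.range q = N)
    (hqP : LinearMap.ker q = ⨆ μ ∈ {μ : ℂ | 0 < μ.im}, f.maxGenEigenspace μ)
    (τ : ℝ) (hτ : τ ∈ Set.Icc (0 : ℝ) 1)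
    (g : Module.End ℂ V)
    (hg : g = ((1 - τ : ℝ) : ℂ) • f - (((τ : ℝ) : ℂ) * Complex.I) • ((2 : ℂ) • q - 1)) :
    (⨆ μ ∈ {μ : ℂ | μ.im < 0}, g.maxGenEigenspace μ) = N := by
  obtain ⟨h0, h1⟩ := hτ
  have hqfix : ∀ x ∈ N, q x = x := by
    intro x hx
    rw [← hqN] at hx
    obtain ⟨y, rfl⟩ := hx
    rw [← Module.End.mul_apply, hq]
  have hle : N ≤ ⨆ μ ∈ {μ : ℂ | μ.im < 0}, g.maxGenEigenspace μ := by
    conv_lhs => rw [hN]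
    refine iSup₂_le fun μ hμ => ?_
    have hμ' : μ.im < 0 := hμ
    refine (gen_aux f g ((1 - τ : ℝ) : ℂ) (-(τ * Complex.I)) μ ?_).trans
      (le_iSup₂_of_le (f := fun (μ : ℂ) (_ : μ ∈ {μ : ℂ | μ.im < 0}) => g.maxGenEigenspace μ)
        _ ?_ le_rfl)
    · intro x hx
      have hxN : x ∈ N := hN ▸ (le_iSup₂_of_le (f := fun (μ : ℂ) (_ : μ ∈ {μ : ℂ | μ.im < 0}) =>
        f.maxGenEigenspace μ) μ hμ le_rfl) hx
      simp only [hg, LinearMap.sub_apply, LinearMap.smul_apply, Module.End.one_apply,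
        hqfix x hxN]
      module
    · simp only [Set.mem_setOf_eq, Complex.add_im, Complex.re_ofReal_mul, Complex.im_ofReal_mul,
        Complex.neg_im, Complex.I_im]
      rcases h0.eq_or_lt with h | h
      · subst h; simpa using hμ'
      · nlinarith
  have hleP : LinearMap.ker q ≤ ⨆ μ ∈ {μ : ℂ | 0 < μ.im}, g.maxGenEigenspace μ := by
    conv_lhs => rw [hqP]
    refine iSup₂_le fun μ hμ => ?_
    have hμ' : 0 < μ.im := hμ
    refine (gen_aux f g ((1 - τ : ℝ) : ℂ) (τ * Complex.I) μ ?_).trans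
      (le_iSup₂_of_le (f := fun (μ : ℂ) (_ : μ ∈ {μ : ℂ | 0 < μ.im}) => g.maxGenEigenspace μ)
        _ ?_ le_rfl)
    · intro x hx
      have hxP : x ∈ LinearMap.ker q :=
        hqP ▸ (le_iSup₂_of_le (f := fun (μ : ℂ) (_ : μ ∈ {μ : ℂ | 0 < μ.im}) =>
          f.maxGenEigenspace μ) μ hμ le_rfl) hx
      simp only [hg, LinearMap.sub_apply, LinearMap.smul_apply, Module.End.one_apply,
        LinearMap.mem_ker.1 hxP]
      module
    · simp only [Set.mem_setOf_eq, Complex.add_im, Complex.im_ofReal_mul, Complex.I_im]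
      rcases h0.eq_or_lt with h | h
      · subst h; simpa using hμ'
      · nlinarith
  have hdisj : Disjoint (⨆ μ ∈ {μ : ℂ | μ.im < 0}, g.maxGenEigenspace μ)
      (⨆ μ ∈ {μ : ℂ | 0 < μ.im}, g.maxGenEigenspace μ) := by
    refine (Module.End.independent_maxGenEigenspace g).disjoint_biSup_biSup ?_
    exact Set.disjoint_left.2 fun μ (a : μ.im < 0) (b : 0 < μ.im) => lt_asymm a b
  refine le_antisymm (fun x hx => ?_) hle
  have hqx : q x ∈ N := hqN ▸ LinearMap.mem_range_self q x
  have hk : x - q x ∈ LinearMap.ker q := by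
    rw [LinearMap.mem_ker, map_sub, hqfix _ hqx, sub_self]
  have := Submodule.disjoint_def.1 hdisj _ (Submodule.sub_mem _ hx (hle hqx)) (hleP hk)
  rw [sub_eq_zero.1 this]
  exact hqx
end
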